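/- (Claim 13) Let n ≥ 3 and 2 ≤ s ≤ k−1 be integers, and let A ⊆ [k]^n be a compressed set with B_{≥1} ⊆ A, |A| ≥ |B_{≥1}| + 2, and |B_{≥1} ∪ ([s]^n ∩ B_0)| < |A| ≤ |B_{≥1} ∪ ([s+1]^n ∩ B_0)|, where [m]^n = {0,…,m−1}^n. Then there exists a compressed set B ⊆ [k]^n with |B| = |A|, B_{≥1} ∪ ([s]^n ∩ B_0) ⊆ B ⊆ B_{≥1} ∪ ([s+1]^n ∩ B_0), and |d(A)| ≥ |d(B)|. -/

import Mathlib

open Finset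
open scoped Classical

/-- `R_i(x)`: the set of coordinates of `x` equal to `i`.
The ambient alphabet is `[k+1] = {0,…,k}`. -/
noncomputable def rset {k N : ℕ} (x : Fin N → Fin (k + 1)) (i : ℕ) : Finset (Fin N) :=
  Finset.univ.filter fun j => (x j : ℕ) = i

/-- the strict binary order on finite sets of coordinates:
`X <_bin Y` iff `X ≠ Y` and `max (X Δ Y) ∈ Y`. -/
def binLT {N : ℕ} (X Y : Finset (Fin N)) : Prop :=
  ∃ m ∈ Y, m ∉ X ∧ ∀ j : Fin N, ((j ∈ X ∧ j ∉ Y) ∨ (j ∈ Y ∧ j ∉ X)) → j ≤ m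

/-- the strict `≤`-order on `[k+1]^N`: `x < y` iff `|R_0(x)| > |R_0(y)|`, or
`|R_0(x)| = |R_0(y)|` and for the largest `i` with `R_i(x) ≠ R_i(y)` we have
`max (R_i(x) Δ R_i(y)) ∈ R_i(y)`. -/
def plt {k N : ℕ} (x y : Fin N → Fin (k + 1)) : Prop :=
  (rset y 0).card < (rset x 0).card ∨
    ((rset x 0).card = (rset y 0).card ∧
      ∃ i : ℕ, binLT (rset x i) (rset y i) ∧ ∀ j : ℕ, i < j → rset x j = rset y j)

/-- the `≤`-order on `[k+1]^N`. -/
def ple {k N : ℕ} (x y : Fin N → Fin (k + 1)) : Prop := x = y ∨ plt x y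

/-- `B` is an initial segment of the `≤`-order. -/
def isInitSeg {k N : ℕ} (B : Finset (Fin N → Fin (k + 1))) : Prop :=
  ∀ y ∈ B, ∀ x, ple x y → x ∈ B

/-- the `d`-shadow: all points obtained from a point of `A` by flipping one
nonzero coordinate to `0`. -/
noncomputable def dShadow {k N : ℕ} (A : Finset (Fin N → Fin (k + 1))) :
    Finset (Fin N → Fin (k + 1)) :=
  A.biUnion fun x =>
    (Finset.univ.filter fun i => x i ≠ 0).image fun i => Function.update x i 0

/-- the initial segment of the `≤`-order on `[k+1]^N` of cardinality `m`. -/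
noncomputable def initSeg (k N m : ℕ) : Finset (Fin N → Fin (k + 1)) :=
  Finset.univ.filter fun x => (Finset.univ.filter fun y => ple y x).card ≤ m

/-- the `C_s`-compression of `A ⊆ [k+1]^(n+1)`: replace each slice
`A_{s,t} = {y : t_s y ∈ A}` by the initial segment of the same size. -/
noncomputable def compress {k n : ℕ} (s : Fin (n + 1)) (A : Finset (Fin (n + 1) → Fin (k + 1))) :
    Finset (Fin (n + 1) → Fin (k + 1)) :=
  Finset.univ.biUnion fun t : Fin (k + 1) =>
    (initSeg k n
        (Finset.univ.filter fun y : Fin n → Fin (k + 1) => s.insertNth t y ∈ A).card).image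
      fun y => s.insertNth t y

/-- `A` is compressed if every `C_s`-compression fixes it. -/
def IsCompressed {k n : ℕ} (A : Finset (Fin (n + 1) → Fin (k + 1))) : Prop :=
  ∀ s : Fin (n + 1), compress s A = A

/-- `B_r`: points with exactly `r` zero coordinates. -/
noncomputable def Bexact (k N r : ℕ) : Finset (Fin N → Fin (k + 1)) :=
  Finset.univ.filter fun x => (rset x 0).card = r

/-- `B_{≥r}`: points with at least `r` zero coordinates. -/
noncomputable def Bge (k N r : ℕ) : Finset (Fin N → Fin (k + 1)) :=
  Finset.univ.filter fun x => r ≤ (rset x 0).card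

/-- `m(x)`: the largest coordinate value of `x`. -/
noncomputable def mval {k N : ℕ} (x : Fin N → Fin (k + 1)) : ℕ :=
  Finset.univ.sup fun i => (x i : ℕ)

/-- the class `C_X`: points with maximal coordinate `s`, attained exactly on `X`,
and exactly `r` zero coordinates. -/
noncomputable def classSet (k N s r : ℕ) (X : Finset (Fin N)) : Finset (Fin N → Fin (k + 1)) :=
  Finset.univ.filter fun x => mval x = s ∧ rset x s = X ∧ (rset x 0).card = r

/-- `[m]^N = {0,…,m−1}^N`. -/
noncomputable def box (k N m : ℕ) : Finset (Fin N → Fin (k + 1)) :=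
  Finset.univ.filter fun x => ∀ i, (x i : ℕ) < m

/-- `{1,…,s−1}^N`. -/
noncomputable def box1 (k N s : ℕ) : Finset (Fin N → Fin (k + 1)) :=
  Finset.univ.filter fun x => ∀ i, 1 ≤ (x i : ℕ) ∧ (x i : ℕ) ≤ s - 1

/-- `B` is a down-set. -/
def isDownSet {k N : ℕ} (B : Finset (Fin N → Fin (k + 1))) : Prop :=
  ∀ y ∈ B, ∀ x : Fin N → Fin (k + 1), (∀ j, (x j : ℕ) ≤ (y j : ℕ)) → x ∈ B


/-- direct form of the order on points with the same number of zeros -/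
def plt0 {k N : ℕ} (x y : Fin N → Fin (k + 1)) : Prop :=
  ∃ p, x p ≠ y p ∧ ∀ j, x j ≠ y j →
    ((x j).val < (y p).val ∨ ((x j).val = (y p).val ∧ j < p))

theorem plt0_iff {k N : ℕ} (x y : Fin N → Fin (k + 1)) :
    (∃ i : ℕ, binLT (rset x i) (rset y i) ∧ ∀ j : ℕ, i < j → rset x j = rset y j) ↔
      plt0 x y := by
  constructor
  · rintro ⟨i, ⟨m, hmY, hmX, hm⟩, hi⟩
    simp only [rset, mem_filter, mem_univ, true_and] at hmY hmX hm
    refine ⟨m, fun h => hmX (by rw [h]; exact hmY), fun j hj => ?_⟩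
    have hle : (x j).val ≤ i := by
      by_contra hlt
      have h := hi (x j).val (by omega)
      have h2 : j ∈ rset x (x j).val := by simp [rset]
      rw [h] at h2
      simp only [rset, mem_filter, mem_univ, true_and] at h2
      exact hj (Fin.ext h2.symm)
    rcases lt_or_eq_of_le hle with h | h
    · left; omega
    · right
      refine ⟨by omega, lt_of_le_of_ne (hm j (Or.inl ⟨h, fun h' => hj (Fin.ext (by omega))⟩)) ?_⟩
      rintro rfl
      exact hmX h
  · rintro ⟨p0, hp0, h0⟩
    obtain ⟨p, hp, hmax⟩ := Finset.exists_max_image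
      (Finset.univ.filter fun j => x j ≠ y j) (fun j => toLex ((y j).val, j)) ⟨p0, by simpa using hp0⟩
    simp only [mem_filter, mem_univ, true_and, Prod.Lex.toLex_le_toLex] at hp hmax
    have hxx : ∀ j, x j ≠ y j →
        ((x j).val < (y p).val ∨ ((x j).val = (y p).val ∧ j < p)) := by
      intro j hj
      have h1 := h0 j hj
      have h2 := hmax p0 hp0
      simp only [Fin.lt_def, Fin.le_def] at *
      omega
    have hv : ∀ j, x j ≠ y j ↔ (x j).val ≠ (y j).val := fun j => by rw [Ne, Fin.ext_iff]
    refine ⟨(y p).val, ⟨p, by simp [rset], ?_, ?_⟩, ?_⟩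
    · simp only [rset, mem_filter, mem_univ, true_and]; exact (hv p).1 hp
    · intro j
      simp only [rset, mem_filter, mem_univ, true_and]
      have h1 := hxx j
      have h2 := hmax j
      rw [hv] at h1 h2
      simp only [Fin.lt_def, Fin.le_def] at *
      omega
    · intro j hj
      ext a
      simp only [rset, mem_filter, mem_univ, true_and]
      have h1 := hxx a
      have h2 := hmax a
      rw [hv] at h1 h2
      omega

/-- a sort key realising the order -/
noncomputable def pkey {k N : ℕ} (x : Fin N → Fin (k + 1)) :
    ℕᵒᵈ ×ₗ Colex (Finset (ℕ ×ₗ Fin N)) :=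
  toLex (OrderDual.toDual (rset x 0).card,
    toColex (Finset.univ.image fun j => toLex ((x j).val, j)))

theorem colex_iff {k N : ℕ} (x y : Fin N → Fin (k + 1)) :
    (toColex (Finset.univ.image fun j => toLex ((x j).val, j)) : Colex (Finset (ℕ ×ₗ Fin N))) <
    toColex (Finset.univ.image fun j => toLex ((y j).val, j)) ↔ plt0 x y := by
  rw [Finset.Colex.toColex_lt_toColex_iff_exists_forall_lt]
  have key : ∀ (u v : Fin N → Fin (k+1)) (j : Fin N),
      (toLex ((u j).val, j) ∉ (Finset.univ.image fun j => (toLex ((v j).val, j) : ℕ ×ₗ Fin N))) ↔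
        u j ≠ v j := by
    intro u v j
    rw [not_iff_not]
    simp only [mem_image, mem_univ, true_and, EmbeddingLike.apply_eq_iff_eq, Prod.mk.injEq]
    constructor
    · rintro ⟨a, h1, rfl⟩; exact Fin.ext h1.symm
    · intro h; exact ⟨j, by rw [h], rfl⟩
  constructor
  · rintro ⟨a, ha, hax, h⟩
    obtain ⟨p, -, rfl⟩ := Finset.mem_image.1 ha
    refine ⟨p, fun e => (key y x p).1 hax e.symm, fun j hj => ?_⟩
    have := h _ (Finset.mem_image_of_mem _ (Finset.mem_univ j)) ((key x y j).2 hj)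
    rwa [Prod.Lex.toLex_lt_toLex] at this
  · rintro ⟨p, hp, h⟩
    refine ⟨_, Finset.mem_image_of_mem _ (Finset.mem_univ p), (key y x p).2 (Ne.symm hp), ?_⟩
    intro b hb hby
    obtain ⟨j, -, rfl⟩ := Finset.mem_image.1 hb
    rw [Prod.Lex.toLex_lt_toLex]
    exact h j ((key x y j).1 hby)

theorem pkey_lt {k N : ℕ} (x y : Fin N → Fin (k + 1)) :
    pkey x < pkey y ↔ ((rset y 0).card < (rset x 0).card ∨
      ((rset x 0).card = (rset y 0).card ∧ plt0 x y)) := by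
  rw [pkey, pkey, Prod.Lex.toLex_lt_toLex, colex_iff]
  simp

theorem plt_iff {k N : ℕ} (x y : Fin N → Fin (k + 1)) : plt x y ↔ pkey x < pkey y := by
  rw [pkey_lt, plt, plt0_iff]

theorem pkey_inj {k N : ℕ} {x y : Fin N → Fin (k + 1)} (h : pkey x = pkey y) : x = y := by
  have h2 : (toColex (Finset.univ.image fun j => toLex ((x j).val, j)) :
      Colex (Finset (ℕ ×ₗ Fin N))) = toColex (Finset.univ.image fun j => toLex ((y j).val, j)) :=
    congrArg (fun a => (ofLex a).2) h
  rw [toColex_inj] at h2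
  funext j
  have h3 : (toLex ((x j).val, j) : ℕ ×ₗ Fin N) ∈
      Finset.univ.image fun j => (toLex ((y j).val, j) : ℕ ×ₗ Fin N) := by
    rw [← h2]; exact Finset.mem_image_of_mem _ (Finset.mem_univ j)
  obtain ⟨a, -, ha⟩ := Finset.mem_image.1 h3
  simp only [EmbeddingLike.apply_eq_iff_eq, Prod.mk.injEq] at ha
  obtain ⟨h4, rfl⟩ := ha
  exact Fin.ext h4.symm

theorem ple_iff {k N : ℕ} (x y : Fin N → Fin (k + 1)) : ple x y ↔ pkey x ≤ pkey y := by
  rw [ple, plt_iff, le_iff_eq_or_lt]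
  exact or_congr ⟨fun h => by rw [h], pkey_inj⟩ Iff.rfl

theorem initSeg_isInitSeg (k N m : ℕ) : isInitSeg (initSeg k N m) := by
  intro y hy x hxy
  simp only [initSeg, mem_filter, mem_univ, true_and] at hy ⊢
  refine le_trans (Finset.card_le_card ?_) hy
  intro z
  simp only [mem_filter, mem_univ, true_and, ple_iff] at hxy ⊢
  exact fun h => h.trans hxy

theorem initSeg_card_eq {k N : ℕ} {S : Finset (Fin N → Fin (k + 1))} (hS : isInitSeg S) :
    initSeg k N S.card = S := by
  ext x
  simp only [initSeg, mem_filter, mem_univ, true_and]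
  constructor
  · intro h
    by_contra hx
    have : (insert x S).card ≤ S.card := by
      refine le_trans (Finset.card_le_card ?_) h
      intro z hz
      simp only [mem_filter, mem_univ, true_and, ple_iff]
      rcases Finset.mem_insert.1 hz with rfl | hz
      · exact le_rfl
      · by_contra hc
        exact hx (hS z hz x ((ple_iff _ _).2 (le_of_lt (not_le.1 hc))))
    rw [Finset.card_insert_of_notMem hx] at this
    omega
  · intro hx
    refine Finset.card_le_card ?_
    intro z
    simp only [mem_filter, mem_univ, true_and]
    exact fun h => hS x hx z h

theorem exists_initSeg (k N m : ℕ) (hm : m ≤ Fintype.card (Fin N → Fin (k + 1))) :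
    ∃ S : Finset (Fin N → Fin (k + 1)), isInitSeg S ∧ S.card = m := by
  induction m with
  | zero => exact ⟨∅, fun y hy => by simp at hy, rfl⟩
  | succ m ih =>
    obtain ⟨S, hS, hc⟩ := ih (by omega)
    have hne : (Sᶜ).Nonempty := by
      rw [← Finset.card_pos, Finset.card_compl]; omega
    obtain ⟨a, ha, hmin⟩ := Finset.exists_min_image Sᶜ pkey hne
    rw [Finset.mem_compl] at ha
    refine ⟨insert a S, ?_, by rw [Finset.card_insert_of_notMem ha, hc]⟩
    intro y hy x hxy
    by_cases hx : x ∈ S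
    · exact Finset.mem_insert_of_mem hx
    rcases Finset.mem_insert.1 hy with rfl | hy
    · have := hmin x (Finset.mem_compl.2 hx)
      rw [ple_iff] at hxy
      rw [pkey_inj (le_antisymm hxy this)]
      exact Finset.mem_insert_self _ _
    · exact absurd (hS y hy x hxy) hx

theorem initSeg_total {k N : ℕ} {S T : Finset (Fin N → Fin (k + 1))} (hS : isInitSeg S)
    (hT : isInitSeg T) (h : S.card ≤ T.card) : S ⊆ T := by
  by_contra hn
  obtain ⟨a, haS, haT⟩ := Finset.not_subset.1 hn
  have : T ⊂ S := by
    refine Finset.ssubset_iff_subset_ne.2 ⟨fun b hb => ?_, fun e => haT (by rw [e]; exact haS)⟩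
    refine hS a haS b ((ple_iff _ _).2 ?_)
    by_contra hc
    exact haT (hT b hb a ((ple_iff _ _).2 (le_of_lt (not_le.1 hc))))
  have := Finset.card_lt_card this
  omega

theorem zeros_insertNth {k n : ℕ} (s : Fin (n + 1)) (t : Fin (k + 1)) (x : Fin n → Fin (k + 1)) :
    (rset (s.insertNth t x : Fin (n + 1) → Fin (k + 1)) 0).card =
      (if t.val = 0 then 1 else 0) + (rset x 0).card := by
  simp only [rset, Finset.card_filter]
  rw [Fin.sum_univ_succAbove _ s]
  simp

theorem plt0_insertNth {k n : ℕ} (s : Fin (n + 1)) (t : Fin (k + 1)) (x y : Fin n → Fin (k + 1)) :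
    plt0 (s.insertNth t x : Fin (n + 1) → Fin (k + 1)) (s.insertNth t y) ↔ plt0 x y := by
  constructor
  · rintro ⟨p, hp, h⟩
    induction p using s.succAboveCases with
    | x => simp at hp
    | p p =>
      refine ⟨p, by simpa using hp, fun j hj => ?_⟩
      have := h (s.succAbove j) (by simpa using hj)
      simpa using this
  · rintro ⟨p, hp, h⟩
    refine ⟨s.succAbove p, by simpa using hp, fun j hj => ?_⟩
    induction j using s.succAboveCases with
    | x => simp at hj
    | p j => simpa using h j (by simpa using hj)

theorem pkey_insertNth {k n : ℕ} (s : Fin (n + 1)) (t : Fin (k + 1)) (x y : Fin n → Fin (k + 1)) :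
    pkey (s.insertNth t x : Fin (n + 1) → Fin (k + 1)) ≤ pkey (s.insertNth t y : Fin (n + 1) → Fin (k + 1)) ↔ pkey x ≤ pkey y := by
  rw [← not_lt, ← not_lt, pkey_lt, pkey_lt, zeros_insertNth, zeros_insertNth, plt0_insertNth]
  simp

theorem compressed_share {k n : ℕ} {A : Finset (Fin (n + 1) → Fin (k + 1))} (hA : IsCompressed A)
    {x y : Fin (n + 1) → Fin (k + 1)} (i : Fin (n + 1)) (hxy : pkey x ≤ pkey y) (hi : x i = y i)
    (hy : y ∈ A) : x ∈ A := by
  have hx' : x = i.insertNth (y i) (i.removeNth x) := by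
    rw [← hi]; exact (Fin.insertNth_self_removeNth i x).symm
  have hy' : y = i.insertNth (y i) (i.removeNth y) := (Fin.insertNth_self_removeNth i y).symm
  have hle : pkey (i.removeNth x) ≤ pkey (i.removeNth y) := by
    rw [← pkey_insertNth i (y i), ← hx', ← hy']; exact hxy
  rw [← hA i] at hy ⊢
  simp only [compress, mem_biUnion, mem_univ, true_and, mem_image] at hy ⊢
  obtain ⟨t, u, hu, he⟩ := hy
  have ht : t = y i := by rw [← he]; simp
  subst ht
  have hu2 : u = i.removeNth y := by
    conv_rhs => rw [← he]
    simp
  refine ⟨y i, i.removeNth x, ?_, hx'.symm⟩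
  refine initSeg_isInitSeg _ _ _ u hu _ ?_
  rw [ple_iff, hu2]; exact hle

theorem initSeg_compressed {k n : ℕ} {A : Finset (Fin (n + 1) → Fin (k + 1))} (hA : isInitSeg A) :
    IsCompressed A := by
  intro s
  have hsl : ∀ t : Fin (k + 1), isInitSeg
      (Finset.univ.filter fun y : Fin n → Fin (k + 1) => (s.insertNth t y : Fin (n + 1) → Fin (k + 1)) ∈ A) := by
    intro t y hy x hxy
    simp only [mem_filter, mem_univ, true_and] at hy ⊢
    refine hA _ hy _ ?_
    rw [ple_iff] at hxy ⊢
    exact (pkey_insertNth s t x y).2 hxy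
  ext z
  simp only [compress, mem_biUnion, mem_univ, true_and, mem_image]
  constructor
  · rintro ⟨t, u, hu, rfl⟩
    rw [initSeg_card_eq (hsl t)] at hu
    simpa using hu
  · intro hz
    refine ⟨z s, s.removeNth z, ?_, Fin.insertNth_self_removeNth s z⟩
    rw [initSeg_card_eq (hsl _)]
    simpa using hz

theorem zeros_eq_zero {k N : ℕ} {x : Fin N → Fin (k + 1)} :
    (rset x 0).card = 0 ↔ ∀ i, 1 ≤ (x i).val := by
  rw [Finset.card_eq_zero, rset, Finset.filter_eq_empty_iff]
  simp [Nat.one_le_iff_ne_zero]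

theorem nz_lt {k N : ℕ} {x y : Fin N → Fin (k + 1)} (hx : ∀ i, 1 ≤ (x i).val)
    (hy : ∀ i, 1 ≤ (y i).val) : pkey x < pkey y ↔ plt0 x y := by
  rw [pkey_lt, zeros_eq_zero.2 hx, zeros_eq_zero.2 hy]
  simp

theorem fin_one_ne_zero {n : ℕ} : (1 : Fin (n + 3)) ≠ 0 := by simp

theorem fin_two_val {n : ℕ} : (2 : Fin (n + 3)).val = 2 := Nat.mod_eq_of_lt (show 2 < n + 3 by omega)

theorem fin_two_ne_zero {n : ℕ} : (2 : Fin (n + 3)) ≠ 0 := by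
  intro h; have := congrArg Fin.val h; rw [fin_two_val] at this; simp at this

theorem fin_two_ne_one {n : ℕ} : (2 : Fin (n + 3)) ≠ 1 := by
  intro h; have := congrArg Fin.val h; rw [fin_two_val] at this; simp at this

theorem fin_lt_one {n : ℕ} {q : Fin (n + 3)} (h : q < 1) : q = 0 := by
  have : q.val < (1 : Fin (n + 3)).val := h
  rw [Fin.val_one] at this
  apply Fin.ext
  rw [Fin.val_zero]
  omega

theorem fin_cases3 {n : ℕ} (p : Fin (n + 3)) (hp : p ≠ 0) : ∃ q : Fin (n + 3), q ≠ 0 ∧ q ≠ p := by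
  by_cases h : p = 1
  · exact ⟨2, fin_two_ne_zero, by rw [h]; exact fin_two_ne_one⟩
  · exact ⟨1, fin_one_ne_zero, fun e => h e.symm⟩

theorem badpair_struct {k n m : ℕ} {A : Finset (Fin (n + 3) → Fin (k + 1))}
    (hA : IsCompressed A) {x y : Fin (n + 3) → Fin (k + 1)}
    (hx : ∀ i, 1 ≤ (x i).val) (hxm : ∀ i, (x i).val < m) (hxA : x ∉ A)
    (hy : ∀ i, 1 ≤ (y i).val) (hym : ∃ i, m ≤ (y i).val) (hyA : y ∈ A) :
    (y 0).val = m ∧ (∀ q, q ≠ 0 → (y q).val < (x 1).val) ∧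
      (∀ r, r ≠ 0 → r ≠ 1 → (x r).val + 1 = m) := by
  have h10 : (1 : Fin (n + 3)) ≠ 0 := fin_one_ne_zero
  have h20 : (2 : Fin (n + 3)) ≠ 0 := fin_two_ne_zero
  have h21 : (2 : Fin (n + 3)) ≠ 1 := fin_two_ne_one
  have hmid : ∀ (z : Fin (n + 3) → Fin (k + 1)) (i j : Fin (n + 3)), pkey x ≤ pkey z →
      pkey z ≤ pkey y → z i = x i → z j = y j → False := by
    intro z i j h1 h2 hi hj
    exact hxA (compressed_share hA i h1 hi.symm (compressed_share hA j h2 hj hyA))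
  obtain ⟨p, -, hmax⟩ := Finset.exists_max_image (Finset.univ : Finset (Fin (n + 3)))
    (fun j => toLex ((y j).val, j)) ⟨0, by simp⟩
  simp only [mem_univ, Prod.Lex.toLex_le_toLex, true_imp_iff] at hmax
  obtain ⟨i0, hi0⟩ := hym
  have hpm : m ≤ (y p).val := by have := hmax i0; omega
  have hxy : pkey x < pkey y := by
    rw [nz_lt hx hy]
    refine ⟨p, fun e => ?_, fun j _ => ?_⟩
    · have := hxm p; rw [e] at this; omega
    · have := hxm j; omega
  have hne : ∀ i, x i ≠ y i := fun i hi => hxA (compressed_share hA i hxy.le hi hyA)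
  have hp0 : p = 0 := by
    by_contra hp
    obtain ⟨q, hq0, hqp⟩ := fin_cases3 p hp
    let z : Fin (n + 3) → Fin (k + 1) := fun j => if j = p then x p else if j = 0 then y p else y j
    have hz : ∀ i, 1 ≤ (z i).val := by
      intro i; simp only [z]; split_ifs <;> simp [hx, hy]
    refine hmid z p q (le_of_lt ?_) (le_of_lt ?_) (by simp [z]) (by simp [z, hq0, hqp])
    · rw [nz_lt hx hz]
      have hz0 : z 0 = y p := by simp [z, Ne.symm hp]
      refine ⟨0, ?_, fun j _ => ?_⟩ <;> rw [hz0]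
      · intro e; have := hxm 0; rw [e] at this; omega
      · have := hxm j; omega
    · rw [nz_lt hz hy]
      refine ⟨p, by simpa [z] using hne p, fun j hj => ?_⟩
      by_cases h1 : j = p
      · have := hxm p
        subst h1
        simp only [z, if_true]; left; omega
      · by_cases h2 : j = 0
        · right
          subst h2
          simp only [z, if_neg h1, if_true, true_and]
          exact Fin.pos_of_ne_zero hp
        · simp [z, h1, h2] at hj
  subst hp0
  have hylt : ∀ q, q ≠ 0 → (y q).val < (y 0).val := by
    intro q hq
    have := hmax q
    have h3 : ¬ (q ≤ 0) := by rw [Fin.le_zero_iff]; exact hq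
    omega
  have hyk : (y 0).val - 1 < k + 1 := by have := (y 0).isLt; omega
  have h0m : 2 ≤ (y 0).val := by
    have := hylt 1 h10; have := hy 1; omega
  have hxr : ∀ r, r ≠ 0 → r ≠ 1 → (x r).val = (y 0).val - 1 := by
    let c : Fin (k + 1) := ⟨(y 0).val - 1, hyk⟩
    have hc : c.val = (y 0).val - 1 := rfl
    let z : Fin (n + 3) → Fin (k + 1) := fun j => if j = 0 then x 0 else if j = 1 then y 1 else c
    have hz : ∀ i, 1 ≤ (z i).val := by
      intro i; simp only [z]; split_ifs
      · exact hx 0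
      · exact hy 1
      · rw [hc]; omega
    have hzy : pkey z ≤ pkey y := by
      apply le_of_lt
      rw [nz_lt hz hy]
      refine ⟨0, by simpa [z] using hne 0, fun j hj => Or.inl ?_⟩
      simp only [z]
      split_ifs
      · have := hxm 0; omega
      · exact hylt 1 h10
      · rw [hc]; omega
    have hzx : pkey z < pkey x := by
      by_contra h
      exact hmid z 0 1 (not_lt.1 h) hzy (by simp [z]) (by simp [z])
    rw [nz_lt hz hx] at hzx
    obtain ⟨p, hp, h⟩ := hzx
    intro r hr0 hr1
    by_contra hr
    have hzr : z r = c := by simp [z, hr0, hr1]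
    have h1 := h r (by rw [hzr]; intro e; apply hr; rw [← e])
    rw [hzr, hc] at h1
    have := hxm p
    have hrp : r < p := by omega
    have hp0 : p ≠ 0 := by rintro rfl; exact absurd hrp (Fin.not_lt_zero r)
    have hp1 : p ≠ 1 := by
      rintro rfl
      exact hr0 (fin_lt_one hrp)
    apply hp
    have hzp : z p = c := by simp [z, hp0, hp1]
    rw [hzp]
    apply Fin.ext
    rw [hc]; omega
  have hm : (y 0).val = m := by
    have := hxr 2 h20 h21
    have := hxm 2
    omega
  refine ⟨hm, ?_, fun r h0 h1 => by rw [hxr r h0 h1]; omega⟩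
  let o : Fin (k + 1) := ⟨1, by omega⟩
  have ho : o.val = 1 := rfl
  let z : Fin (n + 3) → Fin (k + 1) := fun j => if j = 0 then y 0 else if j = 1 then x 1 else o
  have hz : ∀ i, 1 ≤ (z i).val := by
    intro i; simp only [z]; split_ifs
    · exact hy 0
    · exact hx 1
    · rw [ho]
  have hxz : pkey x ≤ pkey z := by
    apply le_of_lt
    rw [nz_lt hx hz]
    refine ⟨0, by simpa [z] using hne 0, fun j hj => Or.inl ?_⟩
    have := hxm j
    simp only [z, if_true]
    omega
  have hyz : pkey y < pkey z := by
    by_contra h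
    exact hmid z 1 0 hxz (not_lt.1 h) (by simp [z]) (by simp [z])
  rw [nz_lt hy hz] at hyz
  obtain ⟨p, hp, h⟩ := hyz
  have hpz : p ≠ 0 := by rintro rfl; simp [z] at hp
  have hp1 : p = 1 := by
    by_contra hp1
    have hzp : z p = o := by simp [z, hpz, hp1]
    have h1 := h p hp
    rw [hzp, ho] at h1
    have := hy p
    apply hp
    rw [hzp]
    apply Fin.ext
    rw [ho]
    omega
  subst hp1
  have hz1 : z 1 = x 1 := by simp [z]
  rw [hz1] at h
  have key : ∀ q, q ≠ 0 → y q ≠ z q → (y q).val < (x 1).val := by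
    intro q hq hqz
    rcases h q hqz with h1 | ⟨_, h1⟩
    · exact h1
    · exact absurd (fin_lt_one h1) hq
  have key1 := key 1 h10 (by rw [hz1]; exact Ne.symm (hne 1))
  intro q hq
  by_cases hqz : y q = z q
  · by_cases hq1 : q = 1
    · subst hq1; exact key1
    · rw [hqz]
      have hzq : z q = o := by simp [z, hq, hq1]
      rw [hzq, ho]
      have := hy 1
      omega
  · exact key q hq hqz

theorem mem_dShadow {k N : ℕ} {A : Finset (Fin N → Fin (k + 1))} {z : Fin N → Fin (k + 1)} :
    z ∈ dShadow A ↔ ∃ x ∈ A, ∃ i, x i ≠ 0 ∧ Function.update x i 0 = z := by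
  simp [dShadow]

/-- replacing one coordinate by a smaller nonzero value goes down -/
theorem update_lt {k N : ℕ} {x : Fin N → Fin (k + 1)} (hx : ∀ i, 1 ≤ (x i).val) (i : Fin N)
    {c : Fin (k + 1)} (hc : 1 ≤ c.val) (hcx : c.val < (x i).val) :
    pkey (Function.update x i c) < pkey x := by
  rw [nz_lt (fun j => by by_cases h : j = i
                         · subst h; simpa using hc
                         · simpa [h] using hx j) hx]
  refine ⟨i, by simp only [Function.update_self]; intro e; rw [e] at hcx; omega, fun j hj => ?_⟩
  by_cases h : j = i
  · subst h; left; simpa using hcx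
  · simp [h] at hj

/-- the interval between `v` with its smallest coordinate replaced by `1` and `v` -/
theorem interval_lemma {k n : ℕ} {u v w : Fin (n + 3) → Fin (k + 1)} {i : Fin (n + 3)}
    (hu : ∀ j, 1 ≤ (u j).val) (hv : ∀ j, 1 ≤ (v j).val) (hw : ∀ j, 1 ≤ (w j).val)
    (h0 : u 0 = v 0) (hwv : ∀ j, j ≠ i → w j = v j)
    (hi : ∀ j, j ≠ 0 → ((v i).val < (v j).val ∨ (v i).val = (v j).val ∧ i ≤ j))
    (h1 : pkey w < pkey u) (h2 : pkey u ≤ pkey v) : ∀ j, j ≠ i → u j = v j := by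
  intro j hj
  by_contra hne
  have h2' : pkey u < pkey v := by
    refine lt_of_le_of_ne h2 fun e => hne ?_
    rw [pkey_inj e]
  rw [nz_lt hw hu] at h1
  rw [nz_lt hu hv] at h2'
  obtain ⟨p, hp, hP⟩ := h1
  obtain ⟨q, hq, hQ⟩ := h2'
  have hj0 : j ≠ 0 := fun e => hne (by rw [e, h0])
  have a1 := hi j hj0
  have a2 := hP j (by rw [hwv j hj]; exact fun e => hne e.symm)
  rw [hwv j hj] at a2
  have a3 : i ≤ j → i < j := fun h => lt_of_le_of_ne h (Ne.symm hj)
  have a4 := hQ p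
  have a5 : q ≠ i → ((v q).val < (u p).val ∨ ((v q).val = (u p).val ∧ q < p)) := by
    intro hqi
    have := hP q (by rw [hwv q hqi]; exact fun e => hq e.symm)
    rwa [hwv q hqi] at this
  by_cases hup : u p = v p
  · by_cases hpi : p = i
    · subst hpi
      rw [hup] at a2
      simp only [Fin.lt_def, Fin.le_def] at *
      omega
    · exact hp (by rw [hwv p hpi, hup])
  · have a6 := a4 hup
    by_cases hqi : q = i
    · subst hqi
      simp only [Fin.lt_def, Fin.le_def] at *
      omega
    · have a7 := a5 hqi
      simp only [Fin.lt_def, Fin.le_def] at *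
      omega

theorem exchange {k n m : ℕ} {A B : Finset (Fin (n + 3) → Fin (k + 1))}
    (hA : IsCompressed A) (hB : isInitSeg B) (hcard : B.card = A.card)
    (hzA : ∀ x, x ∉ A → ∀ i, 1 ≤ (x i).val) (hzB : ∀ x, x ∉ B → ∀ i, 1 ≤ (x i).val)
    {x0 y0 : Fin (n + 3) → Fin (k + 1)}
    (hx0 : x0 ∉ A) (hx0m : ∀ i, (x0 i).val < m)
    (hy0z : ∀ i, 1 ≤ (y0 i).val) (hy0m : ∃ i, m ≤ (y0 i).val) (hy0 : y0 ∈ A) :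
    (dShadow B).card ≤ (dShadow A).card := by
  by_cases hBA : B ⊆ A
  · rw [Finset.eq_of_subset_of_card_le hBA (by omega)]
  by_cases hAB : A ⊆ B
  · rw [Finset.eq_of_subset_of_card_le hAB (by omega)]
  obtain ⟨e0, he0B, he0A⟩ := Finset.not_subset.1 hBA
  obtain ⟨d0, hd0A, hd0B⟩ := Finset.not_subset.1 hAB
  have H : ∀ x, x ∉ A → (∀ i, (x i).val < m) → ∀ y, (∀ i, 1 ≤ (y i).val) →
      (∃ i, m ≤ (y i).val) → y ∈ A →
      (y 0).val = m ∧ (∀ q, q ≠ 0 → (y q).val < (x 1).val) ∧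
      (∀ r, r ≠ 0 → r ≠ 1 → (x r).val + 1 = m) := fun x h1 h2 y h3 h4 h5 =>
    badpair_struct hA (hzA x h1) h2 h1 h3 h4 h5
  have hlt : ∀ e d, e ∈ B → d ∉ B → pkey e < pkey d := by
    intro e d he hd
    by_contra h
    exact hd (hB e he d ((ple_iff _ _).2 (not_lt.1 h)))
  have hdiff : ∀ e d, e ∈ B → e ∉ A → d ∈ A → d ∉ B → ∀ i, e i ≠ d i :=
    fun e d h1 h2 h3 h4 i hi => h2 (compressed_share hA i (hlt e d h1 h4).le hi h3)
  have hEX : ∀ e, e ∈ B → e ∉ A → ∀ i, (e i).val < m := by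
    intro e heB heA
    have h1 := hlt e d0 heB hd0B
    rw [nz_lt (hzA e heA) (hzB d0 hd0B)] at h1
    obtain ⟨p, hp, h⟩ := h1
    intro i
    by_contra hi
    have h2 := h i (hdiff e d0 heB heA hd0A hd0B i)
    have hd0m : ∃ i, m ≤ (d0 i).val := ⟨p, by omega⟩
    obtain ⟨s1, s2, s3⟩ := H x0 hx0 hx0m d0 (hzB d0 hd0B) hd0m hd0A
    by_cases hp0 : p = 0
    · subst hp0
      have : ¬ (i < 0) := Fin.not_lt_zero i
      omega
    · have := s2 p hp0
      have := hx0m 1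
      omega
  have hDY : ∀ d, d ∈ A → d ∉ B → ∃ i, m ≤ (d i).val := by
    intro d hdA hdB
    by_contra hd
    push Not at hd
    obtain ⟨s1, s2, s3⟩ := H e0 he0A (hEX e0 he0B he0A) y0 hy0z hy0m hy0
    have h1 := hlt e0 d he0B hdB
    rw [nz_lt (hzA e0 he0A) (hzB d hdB)] at h1
    obtain ⟨p, hp, h⟩ := h1
    have h2 := h (Fin.last _) (hdiff e0 d he0B he0A hdA hdB _)
    have h3 := s3 (Fin.last _) (by simp [Fin.ext_iff]) (by simp [Fin.ext_iff])
    have h4 := hd p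
    have h5 : ¬ (Fin.last _ < p) := not_lt.2 (Fin.le_last p)
    omega
  have hd0s := H x0 hx0 hx0m y0 hy0z hy0m hy0
  have hm3 : 3 ≤ m := by
    have := hd0s.2.1 1 fin_one_ne_zero
    have := hx0m 1
    have := hy0z 1
    omega
  have hmk : m ≤ k := by
    have := hd0s.1
    have := (y0 0).isLt
    omega
  let c : Fin (k + 1) := ⟨m - 1, by omega⟩
  have hc : c.val = m - 1 := rfl
  let o : Fin (k + 1) := ⟨1, by omega⟩
  have ho : o.val = 1 := rfl
  let P : Fin (n + 3) → Fin (k + 1) := fun i => if i = 0 then 0 else c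
  -- new shadow points
  have hnew : ∀ z, z ∈ dShadow B → z ∉ dShadow A → z = P ∧
      ∀ c' : Fin (k + 1), c' ≠ 0 → Function.update P 0 c' ∉ A := by
    intro z hz hzA'
    obtain ⟨e, heB, i, hei, rfl⟩ := mem_dShadow.1 hz
    have heA : e ∉ A := fun h => hzA' (mem_dShadow.2 ⟨e, h, i, hei, rfl⟩)
    have hup : ∀ c' : Fin (k + 1), c' ≠ 0 → Function.update e i c' ∉ A := by
      intro c' hc' h
      exact hzA' (mem_dShadow.2 ⟨_, h, i, by simpa using hc', by simp⟩)
    have hem := hEX e heB heA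
    have ho0 : o ≠ 0 := by intro h; have := congrArg Fin.val h; simp [ho] at this
    have hoA := hup o ho0
    have hom : ∀ j, (Function.update e i o j).val < m := by
      intro j
      by_cases hj : j = i
      · subst hj; simp only [Function.update_self]; omega
      · simpa [hj] using hem j
    have s := H _ hoA hom y0 hy0z hy0m hy0
    have hi0 : i = 0 := by
      by_contra hi0
      by_cases hi1 : i = 1
      · subst hi1
        have := s.2.1 1 fin_one_ne_zero
        have := hy0z 1
        simp only [Function.update_self] at *
        omega
      · have := s.2.2 i hi0 hi1
        simp only [Function.update_self] at *
        omega
    subst hi0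
    have se := H _ heA hem y0 hy0z hy0m hy0
    have he1 : (e 1).val + 1 = m := by
      by_contra hne
      let f : Fin (n + 3) → Fin (k + 1) := fun j => if j = 1 then o else c
      have hf : ∀ j, 1 ≤ (f j).val := by
        intro j; simp only [f]; split_ifs
        · rw [ho]
        · rw [hc]; omega
      have hfm : ∀ j, (f j).val < m := by
        intro j; simp only [f]; split_ifs
        · rw [ho]; omega
        · rw [hc]; omega
      have hf0 : f 0 = c := by simp [f]
      have hle : pkey (Function.update e 0 o) < pkey f := by
        rw [nz_lt (hzA _ hoA) hf]
        refine ⟨0, ?_, fun j hj => Or.inl ?_⟩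
        · rw [hf0, Function.update_self]
          intro h; have := congrArg Fin.val h; omega
        · rw [hf0, hc]
          by_cases hj0 : j = 0
          · subst hj0; rw [Function.update_self]; omega
          · by_cases hj1 : j = 1
            · subst hj1
              rw [Function.update_of_ne hj0]
              have := hem 1
              omega
            · exfalso
              apply hj
              rw [Function.update_of_ne hj0]
              have := se.2.2 j hj0 hj1
              apply Fin.ext
              simp only [f, if_neg hj1, hc]
              omega
      have hfA : f ∉ A := by
        intro hfA
        refine hoA (compressed_share hA 2 hle.le ?_ hfA)
        rw [Function.update_of_ne fin_two_ne_zero]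
        have := se.2.2 2 fin_two_ne_zero fin_two_ne_one
        apply Fin.ext
        simp only [f, if_neg fin_two_ne_one, hc]
        omega
      have := (H f hfA hfm y0 hy0z hy0m hy0).2.1 1 fin_one_ne_zero
      simp only [f, if_true, ho] at this
      have := hy0z 1
      omega
    have hpe : ∀ j, j ≠ 0 → e j = P j := by
      intro j hj
      apply Fin.ext
      simp only [P, if_neg hj, hc]
      by_cases hj1 : j = 1
      · subst hj1; omega
      · have := se.2.2 j hj hj1
        omega
    have hupd : ∀ c' : Fin (k + 1), Function.update e 0 c' = Function.update P 0 c' := by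
      intro c'
      funext j
      by_cases hj : j = 0
      · subst hj; simp
      · simp only [Function.update_of_ne hj]; exact hpe j hj
    refine ⟨?_, fun c' hc' => by rw [← hupd]; exact hup c' hc'⟩
    rw [hupd]
    funext j
    by_cases hj : j = 0
    · subst hj; simp [P]
    · simp only [Function.update_of_ne hj]
  -- lost shadow points
  have hlost : ∀ v, v ∈ A → v ∉ B → ∀ i, (v i).val = 1 →
      Function.update v i 0 ∈ dShadow A \ dShadow B := by
    intro v hvA hvB i hvi
    have hvz := hzB v hvB
    rw [Finset.mem_sdiff]
    refine ⟨mem_dShadow.2 ⟨v, hvA, i, ?_, rfl⟩, ?_⟩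
    · intro h; rw [h] at hvi; simp at hvi
    · intro h
      obtain ⟨b, hbB, j, hbj, hbv⟩ := mem_dShadow.1 h
      have hji : j = i := by
        by_contra hji
        have h1 := congrFun hbv j
        rw [Function.update_self, Function.update_of_ne hji] at h1
        have := hvz j
        rw [← h1] at this
        simp at this
      subst hji
      have hbne : ∀ a, a ≠ j → b a = v a := by
        intro a ha
        have h1 := congrFun hbv a
        rwa [Function.update_of_ne ha, Function.update_of_ne ha] at h1
      have hbj1 : 1 ≤ (b j).val := by
        rcases Nat.eq_zero_or_pos (b j).val with h0 | h0
        · exact absurd (Fin.ext h0) hbj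
        · exact h0
      have hbz : ∀ a, 1 ≤ (b a).val := by
        intro a
        by_cases ha : a = j
        · subst ha; exact hbj1
        · rw [hbne a ha]; exact hvz a
      have hveq : v = Function.update b j (v j) := by
        funext a
        by_cases ha : a = j
        · subst ha; simp
        · rw [Function.update_of_ne ha, hbne a ha]
      rcases lt_or_eq_of_le hbj1 with h1 | h1
      · have := update_lt hbz j (c := v j) (by omega) (by omega)
        rw [← hveq] at this
        exact absurd this (not_lt.2 (hlt b v hbB hvB).le)
      · have : v = b := by
          rw [hveq]
          have : v j = b j := Fin.ext (by omega)
          rw [this]; simp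
        exact hvB (this ▸ hbB)
  rw [← Finset.card_sdiff_le_card_sdiff_iff]
  by_cases hemp : dShadow B \ dShadow A = ∅
  · rw [hemp]; simp
  obtain ⟨z, hz⟩ := Finset.nonempty_iff_ne_empty.2 hemp
  rw [Finset.mem_sdiff] at hz
  have hPA := (hnew z hz.1 hz.2).2
  have hle1 : (dShadow B \ dShadow A).card ≤ 1 := by
    rw [Finset.card_le_one]
    intro a ha b hb
    rw [Finset.mem_sdiff] at ha hb
    rw [(hnew a ha.1 ha.2).1, (hnew b hb.1 hb.2).1]
  refine hle1.trans (Finset.card_pos.2 ?_)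
  suffices hex : ∃ v, v ∈ A ∧ v ∉ B ∧ ∃ i, (v i).val = 1 by
    obtain ⟨v, h1, h2, i, h3⟩ := hex
    exact ⟨_, hlost v h1 h2 i h3⟩
  by_cases hXB : ∀ x, x ∉ A → (∀ i, (x i).val < m) → x ∈ B
  · by_contra hno
    push Not at hno
    have hE : m - 1 ≤ (B \ A).card := by
      have : (Finset.Ico 1 m).card ≤ (B \ A).card := by
        refine Finset.card_le_card_of_injOn (fun a => Function.update P 0 (Fin.ofNat (k + 1) a)) ?_ ?_
        · intro a ha
          have ha' := Finset.mem_Ico.1 (Finset.mem_coe.1 ha)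
          have hval : (Fin.ofNat (k + 1) a).val = a := Nat.mod_eq_of_lt (by omega)
          have hnA : Function.update P 0 (Fin.ofNat (k + 1) a) ∉ A := by
            apply hPA
            intro h; have := congrArg Fin.val h; rw [hval] at this; simp at this; omega
          rw [Finset.mem_coe, Finset.mem_sdiff]
          refine ⟨hXB _ hnA fun j => ?_, hnA⟩
          beta_reduce
          by_cases hj : j = 0
          · subst hj; rw [Function.update_self, hval]; omega
          · rw [Function.update_of_ne hj]
            simp only [P, if_neg hj, hc]; omega
        · intro a ha b hb hab
          have ha' := Finset.mem_Ico.1 (Finset.mem_coe.1 ha)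
          have hb' := Finset.mem_Ico.1 (Finset.mem_coe.1 hb)
          have h1 := congrFun hab 0
          simp only [Function.update_self] at h1
          have h2 := congrArg Fin.val h1
          have hval : (Fin.ofNat (k + 1) a).val = a := Nat.mod_eq_of_lt (by omega)
          have hval2 : (Fin.ofNat (k + 1) b).val = b := Nat.mod_eq_of_lt (by omega)
          omega
      simpa using this
    have hDE : (A \ B).card = (B \ A).card := Finset.card_sdiff_comm hcard.symm
    obtain ⟨v, hv, hvmax⟩ := Finset.exists_max_image (A \ B) pkey ⟨d0, by simp [hd0A, hd0B]⟩
    rw [Finset.mem_sdiff] at hv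
    obtain ⟨i, hi, himin⟩ := Finset.exists_min_image
      (Finset.univ.filter fun j : Fin (n + 3) => j ≠ 0) (fun j => toLex ((v j).val, j)) ⟨1, by simp⟩
    simp only [mem_filter, mem_univ, true_and, Prod.Lex.toLex_le_toLex] at hi himin
    have hvz := hzB v hv.2
    have hvi : 1 < (v i).val := lt_of_le_of_ne (hvz i) (Ne.symm (hno v hv.1 hv.2 i))
    have hwlt := update_lt hvz i (c := o) (le_of_eq ho.symm) (by omega)
    have hwA : Function.update v i o ∈ A :=
      compressed_share hA 0 hwlt.le (by rw [Function.update_of_ne (Ne.symm hi)]) hv.1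
    have hwB : Function.update v i o ∈ B := by
      by_contra h
      exact hno _ hwA h i (by rw [Function.update_self])
    have hwz : ∀ j, 1 ≤ (Function.update v i o j).val := by
      intro j
      by_cases hj : j = i
      · subst hj; simp [ho]
      · rw [Function.update_of_ne hj]; exact hvz j
    have hY : ∀ u, u ∈ A → u ∉ B → (u 0).val = m ∧ ∀ q, q ≠ 0 → (u q).val < m := by
      intro u huA huB
      have := H x0 hx0 hx0m u (hzB u huB) (hDY u huA huB) huA
      exact ⟨this.1, fun q hq => (this.2.1 q hq).trans (hx0m 1)⟩
    have hD : (A \ B).card ≤ (Finset.Ico 2 m).card := by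
      have hagree : ∀ u, u ∈ A → u ∉ B → ∀ j, j ≠ i → u j = v j := by
        intro u huA huB
        refine interval_lemma (hzB u huB) hvz hwz ?_ (fun j hj => Function.update_of_ne hj _ _)
          himin (hlt _ u hwB huB) (hvmax u (Finset.mem_sdiff.2 ⟨huA, huB⟩))
        apply Fin.ext
        rw [(hY u huA huB).1, (hY v hv.1 hv.2).1]
      refine Finset.card_le_card_of_injOn (fun u => (u i).val) ?_ ?_
      · intro u hu
        rw [Finset.mem_coe, Finset.mem_sdiff] at hu
        rw [Finset.mem_coe, Finset.mem_Ico]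
        have h1 := hzB u hu.2 i
        have h2 := hno u hu.1 hu.2 i
        exact ⟨by beta_reduce; omega, (hY u hu.1 hu.2).2 i hi⟩
      · intro u hu u' hu' huu
        rw [Finset.mem_coe, Finset.mem_sdiff] at hu hu'
        funext j
        by_cases hj : j = i
        · subst hj; exact Fin.ext huu
        · rw [hagree u hu.1 hu.2 j hj, hagree u' hu'.1 hu'.2 j hj]
    rw [Nat.card_Ico] at hD
    omega
  · push Not at hXB
    obtain ⟨x, hxA, hxm, hxB⟩ := hXB
    let v : Fin (n + 3) → Fin (k + 1) := fun j => if j = 0 then y0 0 else o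
    have hv0 : v 0 = y0 0 := by simp [v]
    have hvj : ∀ j, j ≠ 0 → v j = o := fun j hj => by simp [v, hj]
    have hvz : ∀ j, 1 ≤ (v j).val := by
      intro j
      by_cases hj : j = 0
      · subst hj; rw [hv0]; exact hy0z 0
      · rw [hvj j hj, ho]
    have hvy : pkey v ≤ pkey y0 := by
      by_contra h
      rw [not_le, nz_lt hy0z hvz] at h
      obtain ⟨p, hp, h⟩ := h
      have hp0 : p ≠ 0 := by rintro rfl; exact hp hv0.symm
      have h1 := h p hp
      rw [hvj p hp0, ho] at h1
      have := hy0z p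
      have h2 : ¬ (p < p) := lt_irrefl p
      apply hp
      rw [hvj p hp0]
      apply Fin.ext
      omega
    refine ⟨v, compressed_share hA 0 hvy hv0 hy0, fun hvB => ?_, 1, by rw [hvj 1 fin_one_ne_zero]⟩
    refine hxB (hB v hvB x ((ple_iff _ _).2 (le_of_lt ?_)))
    rw [nz_lt (hzA x hxA) hvz]
    refine ⟨0, fun h => ?_, fun j _ => Or.inl ?_⟩
    · have := hxm 0
      rw [h, hv0] at this
      omega
    · rw [hv0]; have := hxm j; omega

theorem level_mem {k N m : ℕ} {x : Fin N → Fin (k + 1)} :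
    x ∈ Bge k N 1 ∪ (box k N m ∩ Bexact k N 0) ↔
      ((∀ i, 1 ≤ (x i).val) → ∀ i, (x i).val < m) := by
  rw [← zeros_eq_zero]
  simp only [Bge, _root_.box, Bexact, mem_union, mem_inter, mem_filter, mem_univ, true_and]
  constructor
  · rintro (h | h) h0
    · omega
    · exact h.1
  · intro h
    rcases Nat.eq_zero_or_pos (rset x 0).card with h0 | h0
    · exact Or.inr ⟨h h0, h0⟩
    · exact Or.inl h0

theorem level_initSeg (k N m : ℕ) : isInitSeg (Bge k N 1 ∪ (box k N m ∩ Bexact k N 0)) := by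
  intro y hy x hxy
  rw [level_mem] at hy ⊢
  intro hx
  rcases hxy with rfl | hxy
  · exact hy hx
  have hlt := (plt_iff _ _).1 hxy
  have hyz : ∀ i, 1 ≤ (y i).val := by
    rw [← zeros_eq_zero]
    have := zeros_eq_zero.2 hx
    rw [pkey_lt] at hlt
    omega
  have hym := hy hyz
  rw [nz_lt hx hyz] at hlt
  obtain ⟨p, hp, h⟩ := hlt
  intro i
  by_cases he : x i = y i
  · rw [he]; exact hym i
  · have := h i he
    have := hym p
    omega

/-- **Claim 13.** Let `n ≥ 3`, `2 ≤ s ≤ k − 1`, and let `A ⊆ [k]^n` be compressed with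
`B_{≥1} ⊆ A`, `|A| ≥ |B_{≥1}| + 2` and
`|B_{≥1} ∪ ([s]^n ∩ B_0)| < |A| ≤ |B_{≥1} ∪ ([s+1]^n ∩ B_0)|`. Then there is a compressed
set `B` with `|B| = |A|`, `B_{≥1} ∪ ([s]^n ∩ B_0) ⊆ B ⊆ B_{≥1} ∪ ([s+1]^n ∩ B_0)` and
`|d(A)| ≥ |d(B)|`. (Dimension `n ≥ 3` is rendered as `n + 1` with `n ≥ 2`;
alphabet `[k]` as `Fin (k+1)`, so `s ≤ k`.) -/
theorem claim13 (k n s : ℕ) (hn : 2 ≤ n) (hs1 : 2 ≤ s) (hs2 : s ≤ k)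
    (A : Finset (Fin (n + 1) → Fin (k + 1))) (hA : IsCompressed A)
    (hB1 : Bge k (n + 1) 1 ⊆ A)
    (hA2 : (Bge k (n + 1) 1).card + 2 ≤ A.card)
    (h1 : (Bge k (n + 1) 1 ∪ (box k (n + 1) s ∩ Bexact k (n + 1) 0)).card < A.card)
    (h2 : A.card ≤ (Bge k (n + 1) 1 ∪ (box k (n + 1) (s + 1) ∩ Bexact k (n + 1) 0)).card) :
    ∃ B : Finset (Fin (n + 1) → Fin (k + 1)),
      IsCompressed B ∧ B.card = A.card ∧
      Bge k (n + 1) 1 ∪ (box k (n + 1) s ∩ Bexact k (n + 1) 0) ⊆ B ∧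
      B ⊆ Bge k (n + 1) 1 ∪ (box k (n + 1) (s + 1) ∩ Bexact k (n + 1) 0) ∧
      (dShadow B).card ≤ (dShadow A).card := by
  obtain ⟨n, rfl⟩ : ∃ n', n = n' + 2 := ⟨n - 2, by omega⟩
  by_cases hc : (Bge k (n + 2 + 1) 1 ∪ (box k (n + 2 + 1) s ∩ Bexact k (n + 2 + 1) 0) ⊆ A) ∧
      A ⊆ Bge k (n + 2 + 1) 1 ∪ (box k (n + 2 + 1) (s + 1) ∩ Bexact k (n + 2 + 1) 0)
  · exact ⟨A, hA, rfl, hc.1, hc.2, le_rfl⟩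
  obtain ⟨B, hB, hcard⟩ := exists_initSeg k (n + 2 + 1) A.card (Finset.card_le_univ A)
  have hs : Bge k (n + 2 + 1) 1 ∪ (box k (n + 2 + 1) s ∩ Bexact k (n + 2 + 1) 0) ⊆ B :=
    initSeg_total (level_initSeg _ _ _) hB (by omega)
  refine ⟨B, initSeg_compressed hB, hcard, hs,
    initSeg_total hB (level_initSeg _ _ _) (by omega), ?_⟩
  have hz : ∀ C : Finset (Fin (n + 2 + 1) → Fin (k + 1)), Bge k (n + 2 + 1) 1 ⊆ C →
      ∀ x, x ∉ C → ∀ i, 1 ≤ (x i).val := by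
    intro C hC x hx
    rw [← zeros_eq_zero]
    by_contra h0
    exact hx (hC (by simp only [Bge, mem_filter, mem_univ, true_and]; omega))
  have hzA := hz A hB1
  have hzB := hz B (Finset.union_subset_left hs)
  have hmain : ∃ m x y, x ∈ Bge k (n + 2 + 1) 1 ∪ (box k (n + 2 + 1) m ∩ Bexact k (n + 2 + 1) 0) ∧
      x ∉ A ∧ y ∈ A ∧ y ∉ Bge k (n + 2 + 1) 1 ∪ (box k (n + 2 + 1) m ∩ Bexact k (n + 2 + 1) 0) := by
    rw [not_and_or] at hc
    rcases hc with hc | hc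
    · obtain ⟨x, hx, hxA⟩ := Finset.not_subset.1 hc
      obtain ⟨y, hy, hyn⟩ := Finset.exists_mem_notMem_of_card_lt_card h1
      exact ⟨s, x, y, hx, hxA, hy, hyn⟩
    · obtain ⟨y, hy, hyn⟩ := Finset.not_subset.1 hc
      by_contra hcon
      have hsub : Bge k (n + 2 + 1) 1 ∪ (box k (n + 2 + 1) (s + 1) ∩ Bexact k (n + 2 + 1) 0) ⊆ A := by
        intro x hx
        by_contra hxA
        exact hcon ⟨s + 1, x, y, hx, hxA, hy, hyn⟩
      have := Finset.eq_of_subset_of_card_le hsub h2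
      exact hyn (this ▸ hy)
  obtain ⟨m, x, y, hx, hxA, hy, hyn⟩ := hmain
  rw [level_mem] at hx hyn
  push Not at hyn
  exact exchange hA hB hcard hzA hzB hxA (hx (hzA x hxA)) hyn.1 hyn.2 hy
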